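/- arXiv:math/0404466 — 2 statements merged into one kernel-verified Lean document; each statement's English description precedes it below -/
import Mathlib

section
/- Let (A_i, φ_{ij}) be an inductive system of operator algebras with completely contractive connecting homomorphisms. Then the extensions φ̃_{ij}: C*_m(A_j) → C*_m(A_i) make (C*_m(A_i), φ̃_{ij}) an inductive system of C*-algebras, and the inductive limit satisfies lim→ C*_m(A_i) ≅ C*_m(lim→ A_i) as C*-algebras. -/
noncomputable section

open scoped Classical

/-! ## Operator algebras, concretely represented -/

/-- A (concrete) operator algebra: a norm-closed subalgebra of the bounded
operators on a complex Hilbert space. -/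
structure OpAlg where
  H : Type
  [nacg : NormedAddCommGroup H]
  [ips : InnerProductSpace ℂ H]
  [cs : CompleteSpace H]
  carrier : NonUnitalSubalgebra ℂ (H →L[ℂ] H)
  isClosed : IsClosed (carrier : Set (H →L[ℂ] H))

attribute [instance] OpAlg.nacg OpAlg.ips OpAlg.cs

/-- The amplification of an `n × n` matrix of operators on `H` to an operator on
`H ⊕₂ ⋯ ⊕₂ H` (`n` summands, with the Hilbert space norm). -/
def matAmp {H : Type} [NormedAddCommGroup H] [InnerProductSpace ℂ H]
    {n : ℕ} (a : Matrix (Fin n) (Fin n) (H →L[ℂ] H)) :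
    (PiLp 2 fun _ : Fin n => H) →L[ℂ] (PiLp 2 fun _ : Fin n => H) :=
  ((PiLp.continuousLinearEquiv 2 ℂ fun _ : Fin n => H).symm.toContinuousLinearMap.comp
    (ContinuousLinearMap.pi fun i => ∑ j, (a i j).comp (ContinuousLinearMap.proj j))).comp
    (PiLp.continuousLinearEquiv 2 ℂ fun _ : Fin n => H).toContinuousLinearMap

/-- The matrix norm of a matrix over a concrete operator algebra. -/
def matNorm (A : OpAlg) {n : ℕ} (a : Matrix (Fin n) (Fin n) A.carrier) : ℝ :=
  ‖matAmp fun i j => (a i j : A.H →L[ℂ] A.H)‖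

/-- A completely contractive homomorphism of operator algebras. -/
structure CCHom (A B : OpAlg) where
  toHom : A.carrier →ₙₐ[ℂ] B.carrier
  completelyContractive : ∀ (n : ℕ) (a : Matrix (Fin n) (Fin n) A.carrier),
    matNorm B (fun i j => toHom (a i j)) ≤ matNorm A a

/-- A completely isometric homomorphism. -/
def CCHom.CompletelyIsometric {A B : OpAlg} (φ : CCHom A B) : Prop :=
  ∀ (n : ℕ) (a : Matrix (Fin n) (Fin n) A.carrier),
    matNorm B (fun i j => φ.toHom (a i j)) = matNorm A a

/-- Two operator algebras are completely isometrically isomorphic if there is a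
bijective completely isometric homomorphism between them. -/
def CIIso (A B : OpAlg) : Prop :=
  ∃ φ : CCHom A B, Function.Bijective φ.toHom ∧ φ.CompletelyIsometric

/-! ## Directed graphs -/

/-- A directed graph: vertices, edges, and source and range maps. -/
structure DiGraph where
  V : Type
  E : Type
  s : E → V
  r : E → V

/-- A contractive representation of a directed graph in an operator algebra:
vertices go to (self-adjoint) projections, edges go to contractions, compatibly
with the range and source maps. -/
structure GraphRep (Q : DiGraph) (A : OpAlg) where
  v : Q.V → A.carrier
  e : Q.E → A.carrier
  idem : ∀ x, v x * v x = v x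
  selfAdjoint : ∀ x, IsSelfAdjoint (v x : A.H →L[ℂ] A.H)
  contractive : ∀ x, ‖(e x : A.H →L[ℂ] A.H)‖ ≤ 1
  range_mul : ∀ x, v (Q.r x) * e x = e x
  mul_source : ∀ x, e x * v (Q.s x) = e x

/-- The representation generates the operator algebra. -/
def GraphRep.Generates {Q : DiGraph} {A : OpAlg} (ρ : GraphRep Q A) : Prop :=
  closure ((NonUnitalAlgebra.adjoin ℂ (Set.range ρ.v ∪ Set.range ρ.e) :
    NonUnitalSubalgebra ℂ A.carrier) : Set A.carrier) = Set.univ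

/-- A homomorphism extends (intertwines) two representations of the same graph. -/
def ExtendsRep {Q : DiGraph} {A B : OpAlg} (ψ : CCHom A B)
    (ρ : GraphRep Q A) (σ : GraphRep Q B) : Prop :=
  (∀ x, ψ.toHom (ρ.v x) = σ.v x) ∧ (∀ x, ψ.toHom (ρ.e x) = σ.e x)

/-- `(A, ι)` is *the* universal operator algebra of the directed graph `Q`:
`ι` generates, and every contractive representation of `Q` factors uniquely
through a completely contractive homomorphism. -/
def IsUniversalOA (Q : DiGraph) (A : OpAlg) (ι : GraphRep Q A) : Prop :=
  ι.Generates ∧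
    ∀ (B : OpAlg) (σ : GraphRep Q B), ∃! ψ : CCHom A B, ExtendsRep ψ ι σ


/-! ## C*-algebra framework -/

/-- A concrete C*-algebra: a norm-closed star-subalgebra of the bounded operators on
a complex Hilbert space. -/
structure ConcCStar where
  H : Type
  [nacg : NormedAddCommGroup H]
  [ips : InnerProductSpace ℂ H]
  [cs : CompleteSpace H]
  carrier : NonUnitalStarSubalgebra ℂ (H →L[ℂ] H)
  isClosed : IsClosed (carrier : Set (H →L[ℂ] H))

attribute [instance] ConcCStar.nacg ConcCStar.ips ConcCStar.cs

/-- The underlying operator algebra of a concrete C*-algebra. -/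
def ConcCStar.toOpAlg (C : ConcCStar) : OpAlg :=
  ⟨C.H, C.carrier.toNonUnitalSubalgebra, C.isClosed⟩

/-- A `*`-homomorphism between concrete C*-algebras. -/
abbrev StarHom (C D : ConcCStar) := C.carrier →⋆ₙₐ[ℂ] D.carrier

/-- The doubled graph `Q *_{V(Q)} Q^←`: the free product of `Q` and its adjoint graph
amalgamated over the common vertex set. -/
def DiGraph.doubled (Q : DiGraph) : DiGraph :=
  ⟨Q.V, Q.E ⊕ Q.E, Sum.elim Q.s Q.r, Sum.elim Q.r Q.s⟩

/-- A contractive `*`-representation of `Q` in a C*-algebra: a contractive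
representation of `Q *_{V(Q)} Q^←` such that the two copies of each edge are mapped
to mutually adjoint elements. -/
structure StarRep (Q : DiGraph) (C : ConcCStar) where
  toRep : GraphRep Q.doubled C.toOpAlg
  star_eq : ∀ x : Q.E,
    star ((toRep.e (Sum.inl x)).val) = (toRep.e (Sum.inr x)).val

/-- A `*`-homomorphism extends (intertwines) two `*`-representations of the same graph. -/
def StarExtendsRep {Q : DiGraph} {C D : ConcCStar} (ψ : StarHom C D)
    (ρ : StarRep Q C) (σ : StarRep Q D) : Prop :=
  (∀ x, (ψ ⟨(ρ.toRep.v x).val, (ρ.toRep.v x).property⟩).val = (σ.toRep.v x).val) ∧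
  (∀ x, (ψ ⟨(ρ.toRep.e x).val, (ρ.toRep.e x).property⟩).val = (σ.toRep.e x).val)

/-- `(C, ι)` is *the* universal C*-algebra `GC*ₘ(Q)` of the directed graph `Q`:
`ι` generates `C` as a C*-algebra, and every contractive `*`-representation of `Q`
factors uniquely through a `*`-homomorphism. -/
def IsUniversalGCm (Q : DiGraph) (C : ConcCStar) (ι : StarRep Q C) : Prop :=
  closure ((NonUnitalStarAlgebra.adjoin ℂ
      (Set.range ι.toRep.v ∪ Set.range ι.toRep.e) :
    NonUnitalStarSubalgebra ℂ C.carrier) : Set C.carrier) = Set.univ ∧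
  ∀ (D : ConcCStar) (σ : StarRep Q D), ∃! ψ : StarHom C D, StarExtendsRep ψ ι σ

/-- Reinterpret an element of the underlying operator algebra of a concrete C*-algebra. -/
def ConcCStar.el {C : ConcCStar} (x : C.toOpAlg.carrier) : C.carrier :=
  ⟨x.val, x.property⟩

/-- `(C, ρ)` is the maximal C*-algebra `C*ₘ(A)` of the operator algebra `A`: `ρ` is a
completely isometric homomorphism onto a C*-generating copy of `A`, and every completely
contractive homomorphism of `A` into a C*-algebra factors uniquely through a
`*`-homomorphism of `C`. -/
def IsMaxCStar (A : OpAlg) (C : ConcCStar) (ρ : CCHom A C.toOpAlg) : Prop :=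
  ρ.CompletelyIsometric ∧
  closure ((NonUnitalStarAlgebra.adjoin ℂ
      (Set.range fun a => ConcCStar.el (ρ.toHom a)) :
    NonUnitalStarSubalgebra ℂ C.carrier) : Set C.carrier) = Set.univ ∧
  ∀ (D : ConcCStar) (φ : CCHom A D.toOpAlg),
    ∃! ψ : StarHom C D, ∀ a, (ψ (ConcCStar.el (ρ.toHom a))).val = (φ.toHom a).val

/-! ## Statement 12 specific definitions -/

/-- An inductive system of operator algebras with completely contractive connecting
homomorphisms, indexed by a preorder. -/
structure OAIndSystem (I : Type) [Preorder I] where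
  A : I → OpAlg
  φ : ∀ i j, i ≤ j → CCHom (A i) (A j)
  idem : ∀ i (x : (A i).carrier), (φ i i le_rfl).toHom x = x
  comp : ∀ i j k (hij : i ≤ j) (hjk : j ≤ k) (x : (A i).carrier),
    (φ j k hjk).toHom ((φ i j hij).toHom x) = (φ i k (hij.trans hjk)).toHom x

/-- `(L, Φ)` is the inductive limit of the inductive system `S` of operator algebras:
it is the universal cone of completely contractive homomorphisms under the system. -/
def IsOAIndLimit {I : Type} [Preorder I] (S : OAIndSystem I) (L : OpAlg)
    (Φ : ∀ i, CCHom (S.A i) L) : Prop :=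
  (∀ i j (h : i ≤ j) x, (Φ j).toHom ((S.φ i j h).toHom x) = (Φ i).toHom x) ∧
  ∀ (B : OpAlg) (Γ : ∀ i, CCHom (S.A i) B),
    (∀ i j (h : i ≤ j) x, (Γ j).toHom ((S.φ i j h).toHom x) = (Γ i).toHom x) →
    ∃! Λ : CCHom L B, ∀ i x, Λ.toHom ((Φ i).toHom x) = (Γ i).toHom x

/-! ## Star-homomorphisms are completely contractive -/

theorem matAmp_ofMatrix_symm_apply {H : Type} [NormedAddCommGroup H] [InnerProductSpace ℂ H]
    {n : ℕ} (a : CStarMatrix (Fin n) (Fin n) (H →L[ℂ] H)) (x : PiLp 2 fun _ : Fin n => H)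
    (i : Fin n) : matAmp (CStarMatrix.ofMatrix.symm a) x i = ∑ j, a i j (x j) := by
  simp [matAmp]

/-- Amplification as a star-homomorphism from matrices of operators on `H` to operators on the
`n`-fold Hilbert sum of `H`. -/
def matAmpHom (H : Type) [NormedAddCommGroup H] [InnerProductSpace ℂ H] [CompleteSpace H]
    (n : ℕ) : CStarMatrix (Fin n) (Fin n) (H →L[ℂ] H) →⋆ₙₐ[ℂ]
      ((PiLp 2 fun _ : Fin n => H) →L[ℂ] (PiLp 2 fun _ : Fin n => H)) where
  toFun a := matAmp (CStarMatrix.ofMatrix.symm a)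
  map_smul' c a := by
    ext x i
    simp [matAmp_ofMatrix_symm_apply, Finset.smul_sum]
  map_zero' := by
    ext x i
    simp [matAmp_ofMatrix_symm_apply]
  map_add' a b := by
    ext x i
    simp [matAmp_ofMatrix_symm_apply, Finset.sum_add_distrib]
  map_mul' a b := by
    ext x i
    simp only [matAmp_ofMatrix_symm_apply, CStarMatrix.mul_apply, sum_apply,
      mul_apply_eq_comp, map_sum]
    exact Finset.sum_comm
  map_star' a := by
    rw [ContinuousLinearMap.star_eq_adjoint, ContinuousLinearMap.eq_adjoint_iff]
    intro x y
    simp only [PiLp.inner_apply, matAmp_ofMatrix_symm_apply, CStarMatrix.star_apply, sum_inner,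
      inner_sum, ContinuousLinearMap.star_eq_adjoint, ContinuousLinearMap.adjoint_inner_left]
    exact Finset.sum_comm

theorem matAmpHom_injective (H : Type) [NormedAddCommGroup H] [InnerProductSpace ℂ H]
    [CompleteSpace H] (n : ℕ) : Function.Injective (matAmpHom H n) := by
  intro a b hab
  ext i j x
  have h : matAmp (CStarMatrix.ofMatrix.symm a) (PiLp.single 2 j x) i
      = matAmp (CStarMatrix.ofMatrix.symm b) (PiLp.single 2 j x) i :=
    congrArg (fun T : (PiLp 2 fun _ : Fin n => H) →L[ℂ] (PiLp 2 fun _ : Fin n => H) =>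
      T (PiLp.single 2 j x) i) hab
  simpa [matAmp_ofMatrix_symm_apply, Pi.single_apply, apply_ite] using h

/-- The norm of the amplification of a matrix over a faithfully represented C⋆-algebra is the
C⋆-norm of the matrix. -/
theorem norm_matAmp_eq {A H : Type} [NonUnitalCStarAlgebra A] [PartialOrder A]
    [StarOrderedRing A] [NormedAddCommGroup H] [InnerProductSpace ℂ H] [CompleteSpace H]
    (π : A →⋆ₙₐ[ℂ] (H →L[ℂ] H)) (hπ : Function.Injective π) {n : ℕ}
    (a : CStarMatrix (Fin n) (Fin n) A) :
    ‖matAmp fun i j => π (a i j)‖ = ‖a‖ :=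
  NonUnitalStarAlgHom.norm_map ((matAmpHom H n).comp (CStarMatrix.mapₙₐ π))
    ((matAmpHom_injective H n).comp (CStarMatrix.map_injective hπ)) a

/-- Star-homomorphisms of concrete C⋆-algebras are completely contractive. -/
theorem StarHom.norm_matAmp_le {C D : ConcCStar} (ψ : StarHom C D) {n : ℕ}
    (a : Matrix (Fin n) (Fin n) C.carrier) :
    ‖matAmp fun i j => (ψ (a i j) : D.H →L[ℂ] D.H)‖ ≤
      ‖matAmp fun i j => (a i j : C.H →L[ℂ] C.H)‖ := by
  have : IsClosed (C.carrier : Set (C.H →L[ℂ] C.H)) := C.isClosed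
  have : IsClosed (D.carrier : Set (D.H →L[ℂ] D.H)) := D.isClosed
  let _ : PartialOrder C.carrier := CStarAlgebra.spectralOrder C.carrier
  let _ : PartialOrder D.carrier := CStarAlgebra.spectralOrder D.carrier
  have : StarOrderedRing C.carrier := CStarAlgebra.spectralOrderedRing C.carrier
  have : StarOrderedRing D.carrier := CStarAlgebra.spectralOrderedRing D.carrier
  have hC := norm_matAmp_eq (NonUnitalStarSubalgebraClass.subtype C.carrier)
    Subtype.val_injective (CStarMatrix.ofMatrix a)
  have hD := norm_matAmp_eq (NonUnitalStarSubalgebraClass.subtype D.carrier)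
    Subtype.val_injective (CStarMatrix.mapₙₐ ψ (CStarMatrix.ofMatrix a))
  exact hD.trans_le ((NonUnitalStarAlgHom.norm_apply_le
    (CStarMatrix.mapₙₐ (n := Fin n) ψ) (CStarMatrix.ofMatrix a)).trans_eq hC.symm)

/-! ## Composition of completely contractive homomorphisms -/

/-- Composition of completely contractive homomorphisms. -/
def CCHom.comp {A B D : OpAlg} (g : CCHom B D) (f : CCHom A B) : CCHom A D where
  toHom := g.toHom.comp f.toHom
  completelyContractive n a :=
    (g.completelyContractive n fun i j => f.toHom (a i j)).trans (f.completelyContractive n a)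

/-- A star-homomorphism as a completely contractive homomorphism of the underlying operator
algebras. -/
def StarHom.toCCHom {C D : ConcCStar} (ψ : StarHom C D) : CCHom C.toOpAlg D.toOpAlg where
  toHom := (ψ : C.carrier →ₙₐ[ℂ] D.carrier)
  completelyContractive _ a := StarHom.norm_matAmp_le ψ a

/-- Star-homomorphisms out of the maximal C⋆-algebra are determined by their restriction to the
operator algebra. -/
theorem IsMaxCStar.starHom_ext {A : OpAlg} {C D : ConcCStar} {ρ : CCHom A C.toOpAlg}
    (h : IsMaxCStar A C ρ) {f g : StarHom C D}
    (hfg : ∀ a, (f (ConcCStar.el (ρ.toHom a))).val = (g (ConcCStar.el (ρ.toHom a))).val) :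
    f = g :=
  (h.2.2 D ((StarHom.toCCHom g).comp ρ)).unique hfg fun _ => rfl

/-- For an inductive system of operator algebras, the (unique)
`*`-homomorphism extensions of the connecting maps make the maximal C*-algebras
into an inductive system of C*-algebras, and the inductive limit of the maximal
C*-algebras is the maximal C*-algebra of the inductive limit:
`lim→ C*ₘ(Aᵢ) ≅ C*ₘ(lim→ Aᵢ)`. -/
theorem maximal_CStar_preserves_inductive_limits
    (I : Type) [Preorder I] [IsDirected I (· ≤ ·)] (S : OAIndSystem I)
    (C : I → ConcCStar) (ρ : ∀ i, CCHom (S.A i) (C i).toOpAlg)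
    (hC : ∀ i, IsMaxCStar (S.A i) (C i) (ρ i)) :
    (∀ i j (h : i ≤ j), ∃! ψ : StarHom (C i) (C j),
        ∀ x, (ψ (ConcCStar.el ((ρ i).toHom x))).val
          = (((ρ j).toHom ((S.φ i j h).toHom x))).val) ∧
    ∀ (ψ : ∀ i j, i ≤ j → StarHom (C i) (C j)),
      (∀ i j (h : i ≤ j) x, ((ψ i j h) (ConcCStar.el ((ρ i).toHom x))).val
          = ((ρ j).toHom ((S.φ i j h).toHom x)).val) →
      (∀ i j k (hij : i ≤ j) (hjk : j ≤ k) (x : (C i).carrier),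
          ψ j k hjk (ψ i j hij x) = ψ i k (hij.trans hjk) x) ∧
      ∀ (L : OpAlg) (Φ : ∀ i, CCHom (S.A i) L), IsOAIndLimit S L Φ →
      ∀ (M : ConcCStar) (ρM : CCHom L M.toOpAlg), IsMaxCStar L M ρM →
      ∀ (Φt : ∀ i, StarHom (C i) M),
        (∀ i x, ((Φt i) (ConcCStar.el ((ρ i).toHom x))).val
            = (ρM.toHom ((Φ i).toHom x)).val) →
        (∀ i j (h : i ≤ j) (x : (C i).carrier), Φt j (ψ i j h x) = Φt i x) ∧
        (∀ (B : ConcCStar) (Γ : ∀ i, StarHom (C i) B),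
          (∀ i j (h : i ≤ j) (x : (C i).carrier), Γ j (ψ i j h x) = Γ i x) →
          ∃! Λ : StarHom M B, ∀ i (x : (C i).carrier), Λ (Φt i x) = Γ i x) := by
  refine ⟨fun i j h => (hC i).2.2 (C j) ((ρ j).comp (S.φ i j h)), fun ψ hψ => ?_⟩
  have hψ' : ∀ i j (h : i ≤ j) x, ψ i j h (ConcCStar.el ((ρ i).toHom x))
      = ConcCStar.el ((ρ j).toHom ((S.φ i j h).toHom x)) :=
    fun i j h x => Subtype.ext (hψ i j h x)
  refine ⟨?_, ?_⟩
  · intro i j k hij hjk x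
    have h : (ψ j k hjk).comp (ψ i j hij) = ψ i k (hij.trans hjk) := by
      refine (hC i).starHom_ext fun a => ?_
      rw [NonUnitalStarAlgHom.comp_apply, hψ', hψ, hψ, S.comp]
    exact DFunLike.congr_fun h x
  intro L Φ hL M ρM hM Φt hΦt
  have hΦt' : ∀ i x, Φt i (ConcCStar.el ((ρ i).toHom x))
      = ConcCStar.el (ρM.toHom ((Φ i).toHom x)) := fun i x => Subtype.ext (hΦt i x)
  refine ⟨?_, ?_⟩
  · intro i j hij x
    have h : (Φt j).comp (ψ i j hij) = Φt i := by
      refine (hC i).starHom_ext fun a => ?_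
      rw [NonUnitalStarAlgHom.comp_apply, hψ', hΦt, hΦt, hL.1]
    exact DFunLike.congr_fun h x
  intro B Γ hΓ
  obtain ⟨Λ₀, hΛ₀, hΛ₀_unique⟩ := hL.2 B.toOpAlg (fun i => (StarHom.toCCHom (Γ i)).comp (ρ i)) (by
    intro i j hij x
    have h := hΓ i j hij (ConcCStar.el ((ρ i).toHom x))
    rw [hψ'] at h
    exact h)
  obtain ⟨Λ, hΛ, hΛ_unique⟩ := hM.2.2 B Λ₀
  refine ⟨Λ, fun i x => ?_, fun Λ' hΛ' => hΛ_unique Λ' fun a => ?_⟩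
  · have h : Λ.comp (Φt i) = Γ i := by
      refine (hC i).starHom_ext fun a => ?_
      rw [NonUnitalStarAlgHom.comp_apply, hΦt', hΛ, hΛ₀]
      rfl
    exact DFunLike.congr_fun h x
  · have h : (StarHom.toCCHom Λ').comp ρM = Λ₀ := by
      refine hΛ₀_unique _ fun i x => ?_
      have h₁ := hΛ' i (ConcCStar.el ((ρ i).toHom x))
      rw [hΦt'] at h₁
      exact h₁
    rw [← h]
    rfl

end
end

section
/- Let A be an operator algebra and let {φ_t}_{t ∈ [0,1]} be a family of completely contractive endomorphisms of A such that t ↦ φ_t(a) is norm continuous for each a ∈ A. Then the unique *-endomorphism extensions φ̃_t: C*_m(A) → C*_m(A) form a family such that t ↦ φ̃_t(x) is norm continuous for every x ∈ C*_m(A). -/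
noncomputable section

open scoped Classical

lemma norm_matAmp_one {H : Type} [NormedAddCommGroup H] [InnerProductSpace ℂ H]
    (T : H →L[ℂ] H) : ‖matAmp (n := 1) (fun _ _ => T)‖ = ‖T‖ := by
  have happly (v : PiLp 2 fun _ : Fin 1 => H) :
      ‖matAmp (n := 1) (fun _ _ => T) v‖ = ‖T (v 0)‖ := by
    simp [matAmp, PiLp.norm_eq_of_L2]
  refine le_antisymm ?_ ?_
  · refine ContinuousLinearMap.opNorm_le_bound _ (ContinuousLinearMap.opNorm_nonneg _) fun v => ?_
    have hv : ‖v‖ = ‖v 0‖ := by simp [PiLp.norm_eq_of_L2]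
    rw [happly, hv]
    exact T.le_opNorm _
  · refine ContinuousLinearMap.opNorm_le_bound _ (ContinuousLinearMap.opNorm_nonneg _) fun x => ?_
    have h := (matAmp (n := 1) (fun _ _ => T)).le_opNorm (WithLp.toLp 2 fun _ => x)
    rw [happly] at h
    simpa [PiLp.norm_eq_of_L2] using h

/-- A completely contractive homomorphism is contractive. -/
lemma CCHom.norm_apply_le {A B : OpAlg} (φ : CCHom A B) (a : A.carrier) :
    ‖φ.toHom a‖ ≤ ‖a‖ := by
  have h := φ.completelyContractive 1 (fun _ _ => a)
  unfold matNorm at h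
  rw [norm_matAmp_one, norm_matAmp_one] at h
  exact h

lemma CCHom.continuous {A B : OpAlg} (φ : CCHom A B) : Continuous φ.toHom :=
  AddMonoidHomClass.continuous_of_bound φ.toHom 1 fun a => by
    simpa only [one_mul] using φ.norm_apply_le a

/-- A family of `*`-homomorphisms of C*-algebras that is point-norm continuous on a set with
dense generated `*`-subalgebra is point-norm continuous everywhere. -/
lemma NonUnitalStarAlgHom.continuousOn_apply_of_closure_adjoin {X B D : Type*}
    [TopologicalSpace X] [NonUnitalCStarAlgebra B] [NonUnitalCStarAlgebra D]
    {S : Set X} (ψ : X → B →⋆ₙₐ[ℂ] D) {G : Set B}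
    (hdense : closure (NonUnitalStarAlgebra.adjoin ℂ G : Set B) = Set.univ)
    (hG : ∀ x ∈ G, ContinuousOn (fun t => ψ t x) S) (x : B) :
    ContinuousOn (fun t => ψ t x) S := by
  have hadj (y : B) (hy : y ∈ NonUnitalStarAlgebra.adjoin ℂ G) :
      ContinuousOn (fun t => ψ t y) S := by
    induction hy using NonUnitalStarAlgebra.adjoin_induction with
    | mem y hy => exact hG y hy
    | add y z _ _ hy hz => simpa only [map_add] using hy.fun_add hz
    | zero => simpa only [map_zero] using continuousOn_const
    | mul y z _ _ hy hz => simpa only [map_mul] using hy.fun_mul hz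
    | smul c y _ hy => simpa only [map_smul] using hy.fun_const_smul c
    | star y _ hy => simpa only [map_star] using hy.star
  refine continuousOn_of_uniform_approx_of_continuousOn fun u hu => ?_
  obtain ⟨ε, hε, hεu⟩ := Metric.mem_uniformity_dist.1 hu
  obtain ⟨y, hy, hxy⟩ := Metric.mem_closure_iff.1 (hdense ▸ Set.mem_univ x) ε hε
  refine ⟨fun t => ψ t y, hadj y hy, fun t _ => hεu ?_⟩
  rw [dist_eq_norm, ← map_sub]
  rw [dist_eq_norm] at hxy
  exact (NonUnitalStarAlgHom.norm_apply_le (ψ t) _).trans_lt hxy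

/-- **Statement 18.** Let `A` be an operator algebra and `{φ_t}_{t ∈ [0,1]}` a
point-norm continuous family of completely contractive endomorphisms of `A`. Then
the family of unique `*`-endomorphism extensions to the maximal C*-algebra
`C*ₘ(A)` is again point-norm continuous. -/
theorem pointNorm_continuous_extension_to_maximal_CStar
    (A : OpAlg) (C : ConcCStar) (ρ : CCHom A C.toOpAlg) (hC : IsMaxCStar A C ρ)
    (φ : ℝ → CCHom A A)
    (hcont : ∀ a : A.carrier, ContinuousOn (fun t => (φ t).toHom a) (Set.Icc (0 : ℝ) 1))
    (ψ : ℝ → StarHom C C)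
    (hext : ∀ t ∈ Set.Icc (0 : ℝ) 1, ∀ a : A.carrier,
      (ψ t (ConcCStar.el (ρ.toHom a))).val = (ρ.toHom ((φ t).toHom a)).val) :
    ∀ x : C.carrier, ContinuousOn (fun t => ψ t x) (Set.Icc (0 : ℝ) 1) := by
  have : IsClosed (C.carrier : Set (C.H →L[ℂ] C.H)) := C.isClosed
  refine NonUnitalStarAlgHom.continuousOn_apply_of_closure_adjoin ψ hC.2.1 ?_
  rintro _ ⟨a, rfl⟩
  have hρ := continuous_subtype_val.comp_continuousOn (ρ.continuous.comp_continuousOn (hcont a))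
  exact Topology.IsInducing.subtypeVal.continuousOn_iff.2
    (hρ.congr fun t ht => hext t ht a)

end
end
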